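/- Let R be a Noetherian ring, I an ideal, and M a finitely generated R-module. Suppose H^i_I(M) is finitely generated for all i < h and H^i_I(M) = 0 for all i > h. Then H^i_I(M) is I-cofinite for all i. -/

import Mathlib

open CategoryTheory

noncomputable section

universe u

/-- The Krull dimension of a module: `dim R/ann(M)`. -/
def moduleDim (R : Type u) [CommRing R] (M : Type*) [AddCommGroup M] [Module R M] :
    WithBot (WithTop ℕ) :=
  ringKrullDim (R ⧸ Module.annihilator R M)

/-- The depth of `M` with respect to an ideal `J`: the supremum of the lengths of
`M`-regular sequences consisting of elements of `J`. -/
def moduleDepth (R : Type u) [CommRing R] (J : Ideal R) (M : Type*) [AddCommGroup M]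
    [Module R M] : ℕ∞ :=
  sSup {n : ℕ∞ | ∃ rs : List R, (rs.length : ℕ∞) = n ∧ (∀ r ∈ rs, r ∈ J) ∧
    RingTheory.Sequence.IsRegular M rs}

/-- Serre's condition `S_ℓ` : for every prime `p` in the support of `M`,
`depth M_p ≥ min (ℓ, dim M_p)`. -/
def SerreCondition (R : Type u) [CommRing R] (ℓ : ℕ) (M : Type u) [AddCommGroup M]
    [Module R M] : Prop :=
  ∀ p ∈ Module.support R M,
    min ((ℓ : ℕ∞) : WithBot ℕ∞)
        (moduleDim (Localization.AtPrime p.asIdeal) (LocalizedModule p.asIdeal.primeCompl M)) ≤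
      ((moduleDepth (Localization.AtPrime p.asIdeal)
          (IsLocalRing.maximalIdeal (Localization.AtPrime p.asIdeal))
          (LocalizedModule p.asIdeal.primeCompl M) : ℕ∞) : WithBot ℕ∞)

/-- A module `N` over `S` is `J`-cofinite if its support is contained in `V(J)` and all the
modules `Ext^i_S(S/J, N)` are finitely generated. -/
def IsCofinite (S : Type u) [CommRing S] (J : Ideal S) (N : ModuleCat.{u} S) : Prop :=
  Module.support S N ⊆ PrimeSpectrum.zeroLocus (J : Set S) ∧
  ∀ i : ℕ, Module.Finite S
    (((Ext S (ModuleCat.{u} S) i).obj (Opposite.op (ModuleCat.of S (S ⧸ J)))).obj N)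

/-- A ring is catenary if any two saturated chains of primes with the same endpoints have
the same length. -/
def IsCatenaryRing (R : Type u) [CommRing R] : Prop :=
  ∀ c₁ c₂ : LTSeries (PrimeSpectrum R),
    c₁.head = c₂.head → c₁.last = c₂.last →
    (∀ i : Fin c₁.length, c₁.toFun i.castSucc ⋖ c₁.toFun i.succ) →
    (∀ i : Fin c₂.length, c₂.toFun i.castSucc ⋖ c₂.toFun i.succ) →
    c₁.length = c₂.length

/-- A module is indecomposable if it is nonzero and is not the internal direct sum of two
nonzero submodules. -/
def ModuleIndecomposable (R : Type u) [CommRing R] (M : Type*) [AddCommGroup M]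
    [Module R M] : Prop :=
  Nontrivial M ∧ ∀ N₁ N₂ : Submodule R M, IsCompl N₁ N₂ → N₁ = ⊥ ∨ N₂ = ⊥

/-- A module is equidimensional if `dim R/P = dim M` for every minimal prime `P`
of its support (equivalently, of its annihilator). -/
def Equidimensional (R : Type u) [CommRing R] (M : Type*) [AddCommGroup M]
    [Module R M] : Prop :=
  ∀ P ∈ (Module.annihilator R M).minimalPrimes, ringKrullDim (R ⧸ P) = moduleDim R M

/-- A local ring is Cohen-Macaulay if its depth equals its Krull dimension. -/
def IsCMLocalRing (S : Type u) [CommRing S] [IsLocalRing S] : Prop :=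
  ((moduleDepth S (IsLocalRing.maximalIdeal S) S : ℕ∞) : WithBot ℕ∞) = ringKrullDim S

/-- A ring is Cohen-Macaulay if all its localizations at primes are Cohen-Macaulay local
rings. -/
def IsCMRing (S : Type u) [CommRing S] : Prop :=
  ∀ p : PrimeSpectrum S, IsCMLocalRing (Localization.AtPrime p.asIdeal)

section Comparison

open Abelian Limits

universe v

namespace CategoryTheory.ProjectiveResolution

variable {R : Type u} [CommRing R] {C : Type v} [Category.{u} C] [Abelian C] [Linear R C]
  {X Y : C} (P : ProjectiveResolution X)

variable (R Y) in
/-- The underlying morphism of a cocycle of `Hom(P, Y)`. -/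
def cocycleHom (n : ℕ) :
    (P.complex.linearYonedaObj R Y).cycles n →ₗ[R] (P.complex.X n ⟶ Y) :=
  ((P.complex.linearYonedaObj R Y).iCycles n).hom

lemma d_comp_cocycleHom (n : ℕ) (z : (P.complex.linearYonedaObj R Y).cycles n) :
    P.complex.d (n + 1) n ≫ P.cocycleHom R Y n z = 0 :=
  ConcreteCategory.congr_hom ((P.complex.linearYonedaObj R Y).iCycles_d n (n + 1)) z

lemma cocycleHom_injective (n : ℕ) : Function.Injective (P.cocycleHom R Y n) :=
  (ModuleCat.mono_iff_injective ((P.complex.linearYonedaObj R Y).iCycles n)).1 inferInstance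

lemma exists_cocycleHom_eq (n : ℕ) (f : P.complex.X n ⟶ Y) (hf : P.complex.d (n + 1) n ≫ f = 0) :
    ∃ z, P.cocycleHom R Y n z = f := by
  let K := P.complex.linearYonedaObj R Y
  let g : ModuleCat.of R R ⟶ K.X n := ModuleCat.ofHom (LinearMap.toSpanSingleton R _ f)
  have hg : g ≫ K.d n (n + 1) = 0 := by
    ext
    change P.complex.d (n + 1) n ≫ ((1 : R) • f) = 0
    simp [hf]
  refine ⟨K.liftCycles g (n + 1) (by simp) hg (1 : R), ?_⟩
  refine (ConcreteCategory.congr_hom (K.liftCycles_i g (n + 1) (by simp) hg) (1 : R)).trans ?_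
  exact one_smul R f

lemma cocycleHom_toCycles (n p : ℕ) (g : P.complex.X p ⟶ Y) :
    P.cocycleHom R Y n ((P.complex.linearYonedaObj R Y).toCycles p n g) = P.complex.d n p ≫ g :=
  ConcreteCategory.congr_hom ((P.complex.linearYonedaObj R Y).toCycles_i p n) g

lemma homologyπ_surjective (n : ℕ) :
    Function.Surjective ((P.complex.linearYonedaObj R Y).homologyπ n) :=
  (ModuleCat.epi_iff_surjective _).1 inferInstance

section

variable {P} {X' : C} {P' : ProjectiveResolution X'} {f : X' ⟶ X}

variable (R Y) in
/-- The map of complexes `Hom(P, Y) ⟶ Hom(P', Y)` induced by a map of resolutions. -/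
def Hom.linearYonedaMap (φ : Hom P' P f) :
    P.complex.linearYonedaObj R Y ⟶ P'.complex.linearYonedaObj R Y where
  f i := ((linearYoneda R C).obj Y).map (φ.hom.f i).op
  comm' i j _ := by
    ext g
    exact (φ.hom.comm_assoc j i (show P.complex.X i ⟶ Y from g)).symm

lemma _root_.CategoryTheory.unop_comp_inv_unop_eq {D : Type*} [Category* D] {K K' : D}
    {a a' b b' : Dᵒᵖ} (e : a ≅ Opposite.op K) (e' : a' ≅ Opposite.op K') {g : K ⟶ K'}
    {m : a' ⟶ a} (h : m ≫ e.hom = e'.hom ≫ g.op) {r : a ⟶ b} {r' : a' ⟶ b'} {t : b' ⟶ b}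
    (h' : r' ≫ t = m ≫ r) :
    t.unop ≫ r'.unop ≫ e'.inv.unop = (r.unop ≫ e.inv.unop) ≫ g := by
  apply Quiver.Hom.op_inj
  rw [← Iso.inv_comp_eq, ← Category.assoc, ← Iso.eq_comp_inv] at h
  simp [h', ← h]

lemma Hom.isoExt_naturality [EnoughProjectives C] (φ : Hom P' P f) (n : ℕ) :
    ((_root_.Ext R C n).map f.op).app Y ≫ (P'.isoExt n Y).hom =
      (P.isoExt n Y).hom ≫ HomologicalComplex.homologyMap (φ.linearYonedaMap R Y) n :=
  unop_comp_inv_unop_eq ((P.complex.linearYonedaObj R Y).homologyOp n)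
    ((P'.complex.linearYonedaObj R Y).homologyOp n)
    (HomologicalComplex.homologyOp_hom_naturality (φ.linearYonedaMap R Y) n)
    (isoLeftDerivedObj_inv_naturality f P' P φ.hom
      (by simpa using φ.hom_f_zero_comp_π_f_zero) ((linearYoneda R C).obj Y).rightOp n)

end

variable [HasExt.{u} C]

lemma smul_extMk {n : ℕ} (r : R) (f : P.complex.X n ⟶ Y) (m : ℕ) (hm : n + 1 = m)
    (hf : P.complex.d m n ≫ f = 0) :
    r • P.extMk f m hm hf = P.extMk (r • f) m hm (by simp [hf]) := by
  rw [Abelian.Ext.smul_eq_comp_mk₀, extMk_comp_mk₀]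
  congr 1
  simp

lemma eq_zero_of_extMk_zero_eq_zero (f : P.complex.X 0 ⟶ Y)
    (hf : P.complex.d 1 0 ≫ f = 0) (h0 : P.extMk f 1 rfl hf = 0) : f = 0 := by
  rw [← P.extEquivCohomologyClass.apply_eq_iff_eq, extEquivCohomologyClass_extMk,
    extEquivCohomologyClass_zero, CochainComplex.HomComplex.CohomologyClass.mk_eq_zero_iff,
    CochainComplex.HomComplex.Cocycle.toSingleMk_mem_coboundaries_iff _ _ _ _ _ 1 (by simp)] at h0
  obtain ⟨g, hg⟩ := h0
  have hz : IsZero (P.cochainComplex.X 1) := P.cochainComplex.isZero_of_isStrictlyLE 0 1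
  rw [hz.eq_of_src g 0, comp_zero, eq_comm] at hg
  simpa using hg

variable (R Y) in
/-- The map from the cocycles of `Hom(P, Y)` to `Ext`. -/
def cyclesToExt (n : ℕ) :
    (P.complex.linearYonedaObj R Y).cycles n →ₗ[R] Abelian.Ext X Y n where
  toFun z := P.extMk (P.cocycleHom R Y n z) (n + 1) rfl (P.d_comp_cocycleHom n z)
  map_add' x y := by simp [add_extMk]
  map_smul' r x := by simp [smul_extMk]

lemma cyclesToExt_surjective (n : ℕ) : Function.Surjective (P.cyclesToExt R Y n) := by
  intro x
  obtain ⟨f, hf, rfl⟩ := P.extMk_surjective x (n + 1) rfl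
  obtain ⟨z, rfl⟩ := P.exists_cocycleHom_eq (R := R) n f hf
  exact ⟨z, rfl⟩

lemma homologyπ_eq_zero_of_cyclesToExt_eq_zero (n : ℕ)
    (z : (P.complex.linearYonedaObj R Y).cycles n) (hz : P.cyclesToExt R Y n z = 0) :
    (P.complex.linearYonedaObj R Y).homologyπ n z = 0 := by
  cases n with
  | zero =>
    have h0 := P.eq_zero_of_extMk_zero_eq_zero _ (P.d_comp_cocycleHom 0 z) hz
    rw [P.cocycleHom_injective 0 (h0.trans (map_zero _).symm), map_zero]
  | succ p =>
    obtain ⟨g, hg⟩ := (P.extMk_eq_zero_iff _ _ rfl (P.d_comp_cocycleHom _ z) p rfl).1 hz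
    rw [← cocycleHom_toCycles (R := R)] at hg
    rw [← P.cocycleHom_injective _ hg]
    exact ConcreteCategory.congr_hom
      ((P.complex.linearYonedaObj R Y).toCycles_comp_homologyπ p (p + 1)) g

lemma cyclesToExt_toCycles (n p : ℕ) (g : P.complex.X p ⟶ Y) :
    P.cyclesToExt R Y n ((P.complex.linearYonedaObj R Y).toCycles p n g) = 0 := by
  by_cases hp : p + 1 = n
  · exact (P.extMk_eq_zero_iff _ _ rfl (P.d_comp_cocycleHom _ _) p hp).2
      ⟨g, (cocycleHom_toCycles ..).symm⟩
  · have : P.cocycleHom R Y n ((P.complex.linearYonedaObj R Y).toCycles p n g) = 0 := by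
      rw [cocycleHom_toCycles, P.complex.shape _ _ hp, zero_comp]
    simp [cyclesToExt, this]

variable (R Y) in
/-- The comparison map from the cohomology of `Hom(P, Y)` to `Ext`. -/
def homologyToExt (n : ℕ) :
    (P.complex.linearYonedaObj R Y).homology n →ₗ[R] Abelian.Ext X Y n :=
  ((P.complex.linearYonedaObj R Y).sc n |>.descHomology (ModuleCat.ofHom (P.cyclesToExt R Y n))
    (by ext g; exact P.cyclesToExt_toCycles n _ g)).hom

lemma homologyToExt_homologyπ (n : ℕ) (z : (P.complex.linearYonedaObj R Y).cycles n) :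
    P.homologyToExt R Y n ((P.complex.linearYonedaObj R Y).homologyπ n z) =
      P.cyclesToExt R Y n z :=
  ConcreteCategory.congr_hom (((P.complex.linearYonedaObj R Y).sc n).π_descHomology
    (ModuleCat.ofHom (P.cyclesToExt R Y n)) (by ext g; exact P.cyclesToExt_toCycles n _ g)) z

lemma homologyToExt_bijective (n : ℕ) : Function.Bijective (P.homologyToExt R Y n) := by
  constructor
  · rw [injective_iff_map_eq_zero]
    intro x hx
    obtain ⟨z, rfl⟩ := P.homologyπ_surjective n x
    rw [homologyToExt_homologyπ] at hx
    exact P.homologyπ_eq_zero_of_cyclesToExt_eq_zero n z hx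
  · intro x
    obtain ⟨z, rfl⟩ := P.cyclesToExt_surjective (R := R) n x
    exact ⟨_, P.homologyToExt_homologyπ n z⟩

variable {P} {X' : C} {P' : ProjectiveResolution X'} {f : X' ⟶ X}

lemma Hom.homologyToExt_homologyMap (φ : Hom P' P f) (n : ℕ)
    (x : (P.complex.linearYonedaObj R Y).homology n) :
    P'.homologyToExt R Y n (HomologicalComplex.homologyMap (φ.linearYonedaMap R Y) n x) =
      (Abelian.Ext.mk₀ f).comp (P.homologyToExt R Y n x) (zero_add n) := by
  obtain ⟨z, rfl⟩ := P.homologyπ_surjective n x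
  have h1 := ConcreteCategory.congr_hom
    (HomologicalComplex.homologyπ_naturality (φ.linearYonedaMap R Y) n) z
  rw [ConcreteCategory.comp_apply, ConcreteCategory.comp_apply] at h1
  rw [h1, homologyToExt_homologyπ, homologyToExt_homologyπ]
  refine Eq.trans ?_ (mk₀_comp_extMk _ _ rfl (P.d_comp_cocycleHom n z) φ).symm
  have h2 : P'.cocycleHom R Y n
      (HomologicalComplex.cyclesMap (φ.linearYonedaMap R Y) n z) =
      φ.hom.f n ≫ P.cocycleHom R Y n z :=
    ConcreteCategory.congr_hom (HomologicalComplex.cyclesMap_i (φ.linearYonedaMap R Y) n) z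
  simp only [cyclesToExt, LinearMap.coe_mk, AddHom.coe_mk, h2]

variable (R) in
/-- The comparison between the `Ext` defined by derived functors and the derived category. -/
def _root_.CategoryTheory.extLinearEquiv [EnoughProjectives C] (X Y : C) (n : ℕ) :
    ((_root_.Ext R C n).obj (Opposite.op X)).obj Y ≃ₗ[R] Abelian.Ext X Y n :=
  ((projectiveResolution X).isoExt n Y).toLinearEquiv ≪≫ₗ
    LinearEquiv.ofBijective _ ((projectiveResolution X).homologyToExt_bijective n)

lemma _root_.CategoryTheory.extLinearEquiv_naturality [EnoughProjectives C] {X X' : C} (Y : C)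
    (n : ℕ) (f : X' ⟶ X) (x : ((_root_.Ext R C n).obj (Opposite.op X)).obj Y) :
    extLinearEquiv R X' Y n (((_root_.Ext R C n).map f.op).app Y x) =
      (Abelian.Ext.mk₀ f).comp (extLinearEquiv R X Y n x) (zero_add n) := by
  let P := projectiveResolution X
  let P' := projectiveResolution X'
  let φ : Hom P' P f := ⟨lift f P' P, (lift_commutes_zero f P' P).trans (by simp)⟩
  refine Eq.trans ?_ (φ.homologyToExt_homologyMap n ((P.isoExt n Y).hom x))
  exact congrArg (P'.homologyToExt R Y n)
    (ConcreteCategory.congr_hom (φ.isoExt_naturality (R := R) (Y := Y) n) x)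

end CategoryTheory.ProjectiveResolution

end Comparison

namespace LocalCohomologyAux

open Abelian Limits

section

variable {R : Type u} [CommRing R] (I : Ideal R)

/-- The quotient `R ⧸ I ^ t` as an object of the category of modules. -/
abbrev quotPow (t : ℕ) : ModuleCat.{u} R := ModuleCat.of R (R ⧸ I ^ t)

/-- The projection `R ⧸ I ^ t ⟶ R ⧸ I ^ s` for `s ≤ t`. -/
def quotPowProj {s t : ℕ} (hst : s ≤ t) : quotPow I t ⟶ quotPow I s :=
  ModuleCat.ofHom <| Submodule.mapQ _ _ LinearMap.id (Ideal.pow_le_pow_right hst)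

/-- The transition maps of the directed system `Ext (R ⧸ I ^ t) Y i`. -/
def extTrans (i : ℕ) (Y : ModuleCat.{u} R) (s t : ℕ) (hst : s ≤ t) :
    Abelian.Ext (quotPow I s) Y i →ₗ[R] Abelian.Ext (quotPow I t) Y i :=
  (Ext.mk₀ (quotPowProj I hst)).precompOfLinear R Y (zero_add i)

lemma extTrans_apply {i : ℕ} {Y : ModuleCat.{u} R} {s t : ℕ} (hst : s ≤ t)
    (x : Abelian.Ext (quotPow I s) Y i) :
    extTrans I i Y s t hst x = (Ext.mk₀ (quotPowProj I hst)).comp x (zero_add i) := rfl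

lemma quotPowProj_mk {s t : ℕ} (hst : s ≤ t) (r : R) :
    quotPowProj I hst (Ideal.Quotient.mk (I ^ t) r) = Ideal.Quotient.mk (I ^ s) r := rfl

lemma quotPowProj_refl (s : ℕ) : quotPowProj I (le_refl s) = 𝟙 _ := by
  ext
  rfl

lemma quotPowProj_comp {r s t : ℕ} (hrs : r ≤ s) (hst : s ≤ t) :
    quotPowProj I hst ≫ quotPowProj I hrs = quotPowProj I (hrs.trans hst) := by
  ext
  rfl

instance directedSystem_extTrans (i : ℕ) (Y : ModuleCat.{u} R) :
    DirectedSystem (fun t ↦ Abelian.Ext (quotPow I t) Y i)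
      fun s t hst ↦ extTrans I i Y s t hst where
  map_self s x := by
    simp [extTrans_apply, quotPowProj_refl]
  map_map r s t hrs hst x := by
    rw [extTrans_apply, extTrans_apply, extTrans_apply, Ext.mk₀_comp_mk₀_assoc,
      quotPowProj_comp]

/-- The `i`-th local cohomology module, as a direct limit of the modules `Ext (R ⧸ I ^ t) Y i`. -/
abbrev dirLim (i : ℕ) (Y : ModuleCat.{u} R) : Type u :=
  Module.DirectLimit (fun t ↦ Abelian.Ext (quotPow I t) Y i) (extTrans I i Y)

lemma smul_ext_eq_zero {X Y : ModuleCat.{u} R} {i : ℕ} {r : R} (hr : ∀ x : X, r • x = 0)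
    (x : Abelian.Ext X Y i) : r • x = 0 := by
  have h : r • (𝟙 X) = 0 := by
    ext x
    exact hr x
  have h2 : r • x = (Ext.mk₀ (r • 𝟙 X)).comp x (zero_add i) := by
    simp [Ext.mk₀_smul]
  rw [h2, h]
  simp

lemma support_dirLim (i : ℕ) (Y : ModuleCat.{u} R) :
    Module.support R (dirLim I i Y) ⊆ PrimeSpectrum.zeroLocus (I : Set R) := by
  intro p hp r hr
  by_contra hrp
  rw [Module.mem_support_iff'] at hp
  obtain ⟨m, hm⟩ := hp
  obtain ⟨t, x, rfl⟩ := Module.DirectLimit.exists_of m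
  refine hm (r ^ t) (fun h ↦ hrp (p.2.mem_of_pow_mem t h)) ?_
  rw [← map_smul, smul_ext_eq_zero, map_zero]
  intro y
  obtain ⟨y, rfl⟩ := Ideal.Quotient.mk_surjective y
  change Ideal.Quotient.mk (I ^ t) (r ^ t * y) = 0
  exact Ideal.Quotient.eq_zero_iff_mem.2 (Ideal.mul_mem_right _ _ (Ideal.pow_mem_pow hr t))

/-- A levelwise isomorphism up to the transition maps induces an isomorphism of direct limits. -/
lemma nonempty_dirLim_equiv {i j : ℕ} {Y Z : ModuleCat.{u} R}
    (g : ∀ t, Abelian.Ext (quotPow I t) Y i →ₗ[R] Abelian.Ext (quotPow I t) Z j)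
    (hg : ∀ s t (hst : s ≤ t) x, g t (extTrans I i Y s t hst x) = extTrans I j Z s t hst (g s x))
    (hinj : ∀ t x, g t x = 0 → ∃ t', ∃ h : t ≤ t', extTrans I i Y t t' h x = 0)
    (hsurj : ∀ t y, ∃ t', ∃ h : t ≤ t', ∃ x, g t' x = extTrans I j Z t t' h y) :
    Nonempty (dirLim I i Y ≃ₗ[R] dirLim I j Z) := by
  refine ⟨LinearEquiv.ofBijective (Module.DirectLimit.map (f := extTrans I i Y)
    (f' := extTrans I j Z) g fun s t hst ↦ LinearMap.ext (hg s t hst)) ⟨?_, ?_⟩⟩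
  · rw [injective_iff_map_eq_zero]
    intro a ha
    obtain ⟨t, x, rfl⟩ := Module.DirectLimit.exists_of a
    rw [Module.DirectLimit.map_apply_of] at ha
    obtain ⟨s, hts, hs⟩ := Module.DirectLimit.of.zero_exact ha
    rw [← hg] at hs
    obtain ⟨t', hst', ht'⟩ := hinj _ _ hs
    rw [← Module.DirectLimit.of_f (hij := hts), ← Module.DirectLimit.of_f (hij := hst'), ht',
      map_zero]
  · intro b
    obtain ⟨t, y, rfl⟩ := Module.DirectLimit.exists_of b
    obtain ⟨t', h, x, hx⟩ := hsurj t y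
    refine ⟨Module.DirectLimit.of _ _ _ _ t' x, ?_⟩
    rw [Module.DirectLimit.map_apply_of, hx, Module.DirectLimit.of_f]

/-- The local cohomology functor of Mathlib agrees with the direct limit of the `Ext` groups. -/
lemma nonempty_localCohomology_equiv (i : ℕ) (Y : ModuleCat.{u} R) :
    Nonempty ((localCohomology I i).obj Y ≃ₗ[R] dirLim I i Y) := by
  let F := localCohomology.diagram (localCohomology.idealPowersDiagram I) i
  have : HasColimit F :=
    localCohomology.hasColimitDiagram.{u, 0} (localCohomology.idealPowersDiagram I) i
  let e : (localCohomology I i).obj Y ≅ colimit (F ⋙ (evaluation _ _).obj Y) :=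
    colimitObjIsoColimitCompEvaluation F Y
  let G := F ⋙ (evaluation _ _).obj Y
  let a (t : ℕ) : G.obj (Opposite.op (Opposite.op t)) ≃ₗ[R] Abelian.Ext (quotPow I t) Y i :=
    extLinearEquiv R (quotPow I t) Y i
  have ha (s t : ℕ) (hst : s ≤ t) (x) :
      a t (G.map (homOfLE hst).op.op x) = extTrans I i Y s t hst (a s x) :=
    extLinearEquiv_naturality Y i (quotPowProj I hst) x
  have : PreservesFilteredColimitsOfSize.{0, 0} (forget (ModuleCat.{u} R)) :=
    preservesFilteredColimitsOfSize_shrink.{0, u, 0, u} _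
  let L : dirLim I i Y →ₗ[R] (colimit G : ModuleCat.{u} R) :=
    Module.DirectLimit.lift R ℕ _ (extTrans I i Y)
      (fun t ↦ (colimit.ι G (Opposite.op (Opposite.op t))).hom ∘ₗ (a t).symm.toLinearMap) (by
        intro s t hst x
        obtain ⟨x, rfl⟩ := (a s).surjective x
        rw [← ha]
        simp)
  refine ⟨e.toLinearEquiv ≪≫ₗ (LinearEquiv.ofBijective L ⟨?_, ?_⟩).symm⟩
  · rw [injective_iff_map_eq_zero]
    intro z hz
    obtain ⟨t, x, rfl⟩ := Module.DirectLimit.exists_of z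
    obtain ⟨x, rfl⟩ := (a t).surjective x
    have hz' : colimit.ι G (Opposite.op (Opposite.op t)) x =
      colimit.ι G (Opposite.op (Opposite.op t)) 0 := by
      simpa [L] using hz
    obtain ⟨t', f, g, h⟩ := Concrete.colimit_exists_of_rep_eq G _ _ hz'
    obtain ⟨t', rfl⟩ : ∃ k, t' = Opposite.op (Opposite.op k) := ⟨t'.unop.unop, rfl⟩
    have hf : f = (homOfLE f.unop.unop.le).op.op := Subsingleton.elim _ _
    rw [hf, map_zero] at h
    rw [← Module.DirectLimit.of_f (hij := f.unop.unop.le), ← ha, h]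
    simp
  · intro z
    obtain ⟨t, x, rfl⟩ := Concrete.colimit_exists_rep G z
    refine ⟨Module.DirectLimit.of R ℕ _ _ t.unop.unop (a _ x), ?_⟩
    simp [L]

end

section

variable {R : Type u} [CommRing R] (I : Ideal R)

/-- The submodule of elements killed by some power of `I`. -/
def gamma (Y : Type*) [AddCommGroup Y] [Module R Y] : Submodule R Y where
  carrier := {y | ∃ t : ℕ, ∀ r ∈ I ^ t, r • y = 0}
  zero_mem' := ⟨0, fun r _ ↦ smul_zero r⟩
  add_mem' := by
    rintro a b ⟨s, hs⟩ ⟨t, ht⟩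
    refine ⟨max s t, fun r hr ↦ ?_⟩
    rw [smul_add, hs r (Ideal.pow_le_pow_right (le_max_left s t) hr),
      ht r (Ideal.pow_le_pow_right (le_max_right s t) hr), add_zero]
  smul_mem' := by
    rintro c a ⟨s, hs⟩
    exact ⟨s, fun r hr ↦ by rw [smul_comm, hs r hr, smul_zero]⟩

variable {I}

lemma mem_gamma {Y : Type*} [AddCommGroup Y] [Module R Y] {y : Y} :
    y ∈ gamma I Y ↔ ∃ t : ℕ, ∀ r ∈ I ^ t, r • y = 0 := Iff.rfl

lemma map_mem_gamma {Y Z : Type*} [AddCommGroup Y] [Module R Y] [AddCommGroup Z] [Module R Z]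
    (f : Y →ₗ[R] Z) {y : Y} (hy : y ∈ gamma I Y) : f y ∈ gamma I Z := by
  obtain ⟨t, ht⟩ := hy
  exact ⟨t, fun r hr ↦ by rw [← map_smul, ht r hr, map_zero]⟩

lemma gamma_gamma (Y : Type*) [AddCommGroup Y] [Module R Y] : gamma I (gamma I Y) = ⊤ := by
  refine eq_top_iff.2 fun y _ ↦ ?_
  obtain ⟨t, ht⟩ := y.2
  exact ⟨t, fun r hr ↦ Subtype.ext (ht r hr)⟩

lemma gamma_eq_top_of_surjective {Y Z : Type*} [AddCommGroup Y] [Module R Y] [AddCommGroup Z]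
    [Module R Z] (f : Y →ₗ[R] Z) (hf : Function.Surjective f) (hY : gamma I Y = ⊤) :
    gamma I Z = ⊤ := by
  refine eq_top_iff.2 fun z _ ↦ ?_
  obtain ⟨y, rfl⟩ := hf z
  exact map_mem_gamma f (hY ▸ Submodule.mem_top)

/-- On a finitely generated module of torsion elements, a uniform power of `I` vanishes. -/
lemma exists_pow_smul_eq_zero {Y J : Type*} [AddCommGroup Y] [Module R Y] [AddCommGroup J]
    [Module R J] [Module.Finite R J] (g : J →ₗ[R] Y) (hg : ∀ j, g j ∈ gamma I Y) :
    ∃ t : ℕ, ∀ r ∈ I ^ t, ∀ j, g (r • j) = 0 := by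
  obtain ⟨s, hs⟩ := Module.Finite.fg_top (R := R) (M := J)
  choose n hn using hg
  refine ⟨s.sup n, fun r hr j ↦ ?_⟩
  have hj : j ∈ Submodule.span R (s : Set J) := hs ▸ Submodule.mem_top
  induction hj using Submodule.span_induction with
  | mem x hx =>
    rw [map_smul]
    exact hn x r (Ideal.pow_le_pow_right (Finset.le_sup hx) hr)
  | zero => simp
  | add x y _ _ hx hy => rw [smul_add, map_add, hx, hy, add_zero]
  | smul a x _ hx => rw [smul_comm, map_smul, hx, smul_zero]

lemma exists_comp_eq_of_ker_le {A B E : Type u} [AddCommGroup A] [Module R A] [AddCommGroup B]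
    [Module R B] [AddCommGroup E] [Module R E] [Module.Injective R E] (φ : A →ₗ[R] B)
    (g : A →ₗ[R] E) (h : LinearMap.ker φ ≤ LinearMap.ker g) :
    ∃ f : B →ₗ[R] E, ∀ a, f (φ a) = g a := by
  obtain ⟨f, hf⟩ := Module.Injective.out ((LinearMap.ker φ).liftQ φ le_rfl)
    (LinearMap.ker_eq_bot.1 (Submodule.ker_liftQ_eq_bot _ _ _ le_rfl))
    ((LinearMap.ker φ).liftQ g h)
  exact ⟨f, fun a ↦ hf (Submodule.Quotient.mk a)⟩

/-- The torsion submodule of an injective module over a Noetherian ring is injective. -/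
instance injective_gamma [IsNoetherianRing R] (E : Type u) [AddCommGroup E] [Module R E]
    [Module.Injective R E] : Module.Injective R (gamma I E) := by
  refine Module.Baer.injective fun J g ↦ ?_
  obtain ⟨t, ht⟩ := exists_pow_smul_eq_zero ((gamma I E).subtype ∘ₗ g) fun j ↦ (g j).2
  obtain ⟨k, hk⟩ := Ideal.exists_pow_inf_eq_pow_smul I J
  have hle : LinearMap.ker ((I ^ (k + t)).mkQ ∘ₗ J.subtype) ≤
      LinearMap.ker ((gamma I E).subtype ∘ₗ g) := by
    rintro ⟨j, hj⟩ hj'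
    have hj2 : j ∈ I ^ (k + t) := (Submodule.Quotient.mk_eq_zero _).1 hj'
    have hj3 : j ∈ I ^ t • J := by
      have : j ∈ (I ^ (k + t) • ⊤ ⊓ J : Submodule R R) := ⟨by simpa using hj2, hj⟩
      rw [hk (k + t) (by lia), Nat.add_sub_cancel_left] at this
      exact Submodule.smul_mono le_rfl inf_le_right this
    have key : I ^ t • J ≤ (LinearMap.ker ((gamma I E).subtype ∘ₗ g)).map J.subtype :=
      Submodule.smul_le.2 fun r hr n hn ↦ ⟨r • ⟨n, hn⟩, ht r hr _, rfl⟩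
    obtain ⟨j', hj4, rfl⟩ := key hj3
    exact hj4
  obtain ⟨f, hf⟩ := exists_comp_eq_of_ker_le _ _ hle
  refine ⟨(f ∘ₗ (I ^ (k + t)).mkQ).codRestrict (gamma I E) fun x ↦ ⟨k + t, fun r hr ↦ ?_⟩, ?_⟩
  · rw [← map_smul, LinearMap.comp_apply]
    have : (I ^ (k + t)).mkQ (r • x) = 0 :=
      (Submodule.Quotient.mk_eq_zero _).2 (Ideal.mul_mem_right _ _ hr)
    rw [this, map_zero]
  · intro x hx
    exact Subtype.ext (hf ⟨x, hx⟩)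

/-- Every module maps to a torsion-free injective module with kernel the torsion submodule. -/
lemma exists_injective_ker_eq_gamma [IsNoetherianRing R] (Y : ModuleCat.{u} R) :
    ∃ (E : ModuleCat.{u} R) (f : Y →ₗ[R] E), Module.Injective R E ∧ gamma I E = ⊥ ∧
      LinearMap.ker f = gamma I Y := by
  let E₀ : ModuleCat.{u} R := CategoryTheory.Injective.under Y
  let i : Y →ₗ[R] E₀ := (CategoryTheory.Injective.ι Y).hom
  have hi : Function.Injective i := (ModuleCat.mono_iff_injective _).1 inferInstance
  have : CategoryTheory.Injective (ModuleCat.of R E₀) :=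
    inferInstanceAs (CategoryTheory.Injective (CategoryTheory.Injective.under Y))
  have hE₀ : Module.Injective R E₀ := Module.injective_module_of_injective_object R E₀
  obtain ⟨r, hr⟩ := Module.Injective.out (gamma I E₀).subtype (gamma I E₀).subtype_injective
    LinearMap.id
  let p : E₀ →ₗ[R] LinearMap.ker r :=
    (LinearMap.id - (gamma I E₀).subtype ∘ₗ r).codRestrict (LinearMap.ker r) fun x ↦ by
      simp [show r (r x) = r x from hr (r x)]
  have hp (x : E₀) : (p x : E₀) = x - r x := rfl
  refine ⟨ModuleCat.of R (LinearMap.ker r), p ∘ₗ i, ⟨fun X Z _ _ _ _ f hf g ↦ ?_⟩, ?_, ?_⟩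
  · obtain ⟨h, hh⟩ := hE₀.out f hf ((LinearMap.ker r).subtype ∘ₗ g)
    refine ⟨p ∘ₗ h, fun x ↦ Subtype.ext ?_⟩
    simp [hp, hh]
  · refine (Submodule.eq_bot_iff _).2 fun x hx ↦ Subtype.ext ?_
    have h1 := hr ⟨x.1, map_mem_gamma (LinearMap.ker r).subtype hx⟩
    have h2 : r x.1 = 0 := x.2
    simpa [h2] using (congrArg Subtype.val h1).symm
  · ext y
    rw [LinearMap.mem_ker, LinearMap.comp_apply, ← Subtype.coe_inj, hp]
    simp only [ZeroMemClass.coe_zero, sub_eq_zero]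
    constructor
    · intro h
      obtain ⟨t, ht⟩ := (r (i y)).2
      refine ⟨t, fun a ha ↦ hi ?_⟩
      rw [map_smul, map_zero, h, ht a ha]
    · intro h
      exact (congrArg Subtype.val (hr ⟨i y, map_mem_gamma i h⟩)).symm

end

section

variable {R : Type u} [CommRing R] {I : Ideal R}

lemma exists_shortExact_of_injective {A B : ModuleCat.{u} R} (f : A ⟶ B)
    (hf : Function.Injective f) :
    ∃ (C : ModuleCat.{u} R) (g : B ⟶ C) (w : f ≫ g = 0), (ShortComplex.mk f g w).ShortExact :=
  ⟨_, cokernel.π f, cokernel.condition f,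
    { exact := ShortComplex.exact_cokernel f
      mono_f := (ModuleCat.mono_iff_injective f).2 hf }⟩

/-- The quotient of a module by its torsion submodule is torsion-free. -/
lemma exists_shortExact_gamma [IsNoetherianRing R] (I : Ideal R) (Y : ModuleCat.{u} R) :
    ∃ (Q : ModuleCat.{u} R) (i : ModuleCat.of R (gamma I Y) ⟶ Y) (p : Y ⟶ Q) (w : i ≫ p = 0),
      (ShortComplex.mk i p w).ShortExact ∧ gamma I Q = ⊥ := by
  obtain ⟨E, f, -, hE, hf⟩ := exists_injective_ker_eq_gamma (I := I) Y
  refine ⟨_, ModuleCat.ofHom (gamma I Y).subtype, ModuleCat.ofHom f.rangeRestrict, ?_,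
    ModuleCat.shortComplex_shortExact _ (fun y ↦ ?_) (Submodule.subtype_injective _)
      f.surjective_rangeRestrict, ?_⟩
  · ext y
    have hy : y.1 ∈ LinearMap.ker f := by
      rw [hf]
      exact y.2
    exact hy
  · change f.rangeRestrict y = 0 ↔ y ∈ Set.range (gamma I Y).subtype
    rw [← Subtype.coe_inj]
    exact (SetLike.ext_iff.1 hf y).trans (by simp)
  · refine (Submodule.eq_bot_iff _).2 fun x hx ↦ Subtype.ext ?_
    have := map_mem_gamma (LinearMap.range f).subtype hx
    rw [hE] at this
    exact this

/-- A torsion-free module embeds into a torsion-free injective module. -/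
lemma exists_shortExact_injective [IsNoetherianRing R] (Q : ModuleCat.{u} R)
    (hQ : gamma I Q = ⊥) :
    ∃ (E B : ModuleCat.{u} R) (j : Q ⟶ E) (q : E ⟶ B) (w : j ≫ q = 0),
      (ShortComplex.mk j q w).ShortExact ∧ Injective E ∧ gamma I E = ⊥ := by
  obtain ⟨E, f, hE, hE', hf⟩ := exists_injective_ker_eq_gamma (I := I) Q
  obtain ⟨B, q, w, h⟩ := exists_shortExact_of_injective (ModuleCat.ofHom f)
    (LinearMap.ker_eq_bot.1 (hf.trans hQ))
  exact ⟨E, B, _, q, w, h, Module.injective_object_of_injective_module R E, hE'⟩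

section Transition

lemma extTrans_comp {i j k : ℕ} {Y Z : ModuleCat.{u} R} {s t : ℕ} (hst : s ≤ t)
    (x : Abelian.Ext (quotPow I s) Y i) (α : Abelian.Ext Y Z j) (h : i + j = k) :
    extTrans I k Z s t hst (x.comp α h) = (extTrans I i Y s t hst x).comp α h := by
  rw [extTrans_apply, extTrans_apply, Ext.comp_assoc]
  lia

lemma mk₀_comp_extClass {S : ShortComplex (ModuleCat.{u} R)} (hS : S.ShortExact)
    {X : ModuleCat.{u} R} (ψ : X ⟶ S.X₂) :
    (Ext.mk₀ (ψ ≫ S.g)).comp hS.extClass (zero_add 1) = 0 := by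
  rw [← Ext.mk₀_comp_mk₀, Ext.comp_assoc _ _ _ (zero_add 0) (zero_add 1) (by lia),
    hS.comp_extClass, Ext.comp_zero]

variable [IsNoetherianRing R]

lemma exists_shortExact_gamma_eq_top (T : ModuleCat.{u} R) (hT : gamma I T = ⊤) :
    ∃ (J C : ModuleCat.{u} R) (f : T ⟶ J) (g : J ⟶ C) (w : f ≫ g = 0),
      (ShortComplex.mk f g w).ShortExact ∧ Injective J ∧ gamma I J = ⊤ := by
  let E₀ : ModuleCat.{u} R := Injective.under T
  have : Injective (ModuleCat.of R E₀) := inferInstanceAs (Injective (Injective.under T))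
  have hE₀ : Module.Injective R E₀ := Module.injective_module_of_injective_object R E₀
  let f : T ⟶ ModuleCat.of R (gamma I E₀) := ModuleCat.ofHom <|
    (Injective.ι T).hom.codRestrict (gamma I E₀) fun y ↦ map_mem_gamma _ (hT ▸ Submodule.mem_top)
  have hf : Function.Injective f := fun a b hab ↦
    (ModuleCat.mono_iff_injective (Injective.ι T)).1 inferInstance (congrArg Subtype.val hab)
  obtain ⟨C, g, w, hS⟩ := exists_shortExact_of_injective f hf
  exact ⟨_, C, f, g, w, hS, Module.injective_object_of_injective_module R (gamma I E₀),
    gamma_gamma _⟩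

/-- The higher local cohomology of a torsion module vanishes. -/
lemma exists_extTrans_eq_zero_of_gamma_eq_top (i : ℕ) (T : ModuleCat.{u} R)
    (hT : gamma I T = ⊤) (t : ℕ) (x : Abelian.Ext (quotPow I t) T (i + 1)) :
    ∃ t', ∃ h : t ≤ t', extTrans I (i + 1) T t t' h x = 0 := by
  induction i generalizing T with
  | zero =>
    obtain ⟨J, C, f, g, w, hS, hJ, hJ'⟩ := exists_shortExact_gamma_eq_top T hT
    obtain ⟨y, rfl⟩ := Ext.covariant_sequence_exact₁ _ hS x (Ext.eq_zero_of_injective _) rfl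
    obtain ⟨φ, rfl⟩ := (Ext.mk₀_bijective (quotPow I t) C).2 y
    obtain ⟨j, hj⟩ := hS.moduleCat_surjective_g (φ (Ideal.Quotient.mk (I ^ t) 1))
    obtain ⟨s, hs⟩ : j ∈ gamma I J := hJ' ▸ Submodule.mem_top
    refine ⟨max t s, le_max_left _ _, ?_⟩
    let ψ : quotPow I (max t s) ⟶ J := ModuleCat.ofHom <|
      (I ^ (max t s)).liftQ (LinearMap.toSpanSingleton R J j) fun r hr ↦
        hs r (Ideal.pow_le_pow_right (le_max_right _ _) hr)
    have hψ : quotPowProj I (le_max_left t s) ≫ φ = ψ ≫ g := by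
      ext
      change φ (Ideal.Quotient.mk (I ^ t) 1) = g ((1 : R) • j)
      rw [one_smul, ← hj]
    refine (extTrans_comp _ _ hS.extClass (zero_add 1)).trans ?_
    rw [extTrans_apply, Ext.mk₀_comp_mk₀, hψ]
    exact mk₀_comp_extClass hS ψ
  | succ i ih =>
    obtain ⟨J, C, f, g, w, hS, hJ, hJ'⟩ := exists_shortExact_gamma_eq_top T hT
    obtain ⟨y, rfl⟩ := Ext.covariant_sequence_exact₁ _ hS x (Ext.eq_zero_of_injective _) rfl
    obtain ⟨t', h, ht'⟩ := ih C (gamma_eq_top_of_surjective g.hom hS.moduleCat_surjective_g hJ') y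
    refine ⟨t', h, (extTrans_comp h y hS.extClass rfl).trans ?_⟩
    exact (congrArg (fun z ↦ Ext.comp z hS.extClass rfl) ht').trans (Ext.zero_comp ..)

end Transition

section Injective

variable {E X : ModuleCat.{u} R}

lemma subsingleton_ext_zero_of_gamma_eq_bot (hE : gamma I E = ⊥) {t : ℕ}
    (hX : ∀ r ∈ I ^ t, ∀ x : X, r • x = 0) : Subsingleton (Abelian.Ext X E 0) := by
  refine subsingleton_of_forall_eq 0 fun y ↦ ?_
  obtain ⟨φ, rfl⟩ := (Ext.mk₀_bijective _ _).2 y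
  have : φ = 0 := by
    ext x
    have hx : φ x ∈ gamma I E := ⟨t, fun r hr ↦ by rw [← map_smul, hX r hr, map_zero]⟩
    rw [hE] at hx
    exact hx
  rw [this, Ext.mk₀_zero]

lemma subsingleton_ext_of_gamma_eq_bot [Injective E] (hE : gamma I E = ⊥) {t : ℕ}
    (hX : ∀ r ∈ I ^ t, ∀ x : X, r • x = 0) : ∀ n : ℕ, Subsingleton (Abelian.Ext X E n)
  | 0 => subsingleton_ext_zero_of_gamma_eq_bot hE hX
  | n + 1 => Ext.subsingleton_of_injective X E n

lemma smul_quotPow_eq_zero (t : ℕ) : ∀ r ∈ I ^ t, ∀ x : quotPow I t, r • x = 0 := by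
  intro r hr x
  obtain ⟨x, rfl⟩ := Ideal.Quotient.mk_surjective x
  exact Ideal.Quotient.eq_zero_iff_mem.2 (Ideal.mul_mem_right _ _ hr)

variable {A B : ModuleCat.{u} R} {j : A ⟶ E} {q : E ⟶ B} {w : j ≫ q = 0}

/-- The dimension shifting isomorphism. -/
lemma bijective_postcomp_extClass (hS : (ShortComplex.mk j q w).ShortExact) (n : ℕ)
    (h₀ : Subsingleton (Abelian.Ext X E n)) (h₁ : Subsingleton (Abelian.Ext X E (n + 1))) :
    Function.Bijective (hS.extClass.postcompOfLinear R X (show n + 1 = n + 1 from rfl)) := by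
  constructor
  · rw [injective_iff_map_eq_zero]
    intro x hx
    obtain ⟨y, rfl⟩ := Ext.covariant_sequence_exact₃ X hS x rfl hx
    rw [Subsingleton.elim y 0, Ext.zero_comp]
  · intro x
    exact Ext.covariant_sequence_exact₁ X hS x (Subsingleton.elim _ _) rfl

/-- Dimension shifting for local cohomology along an embedding into a torsion-free injective. -/
lemma nonempty_dirLim_equiv_succ [Injective E] (hS : (ShortComplex.mk j q w).ShortExact)
    (hE : gamma I E = ⊥) (i : ℕ) :
    Nonempty (dirLim I i B ≃ₗ[R] dirLim I (i + 1) A) := by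
  have hb (t : ℕ) := bijective_postcomp_extClass hS (X := quotPow I t) i
    (subsingleton_ext_of_gamma_eq_bot hE (smul_quotPow_eq_zero t) i)
    (subsingleton_ext_of_gamma_eq_bot hE (smul_quotPow_eq_zero t) (i + 1))
  refine nonempty_dirLim_equiv I
    (fun t ↦ hS.extClass.postcompOfLinear R (quotPow I t) (show i + 1 = i + 1 from rfl))
    (fun s t hst x ↦ (extTrans_comp hst x hS.extClass rfl).symm) (fun t x hx ↦ ?_)
    fun t y ↦ ⟨t, le_rfl, (hb t).2 _⟩
  refine ⟨t, le_rfl, ?_⟩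
  rw [(hb t).1 (hx.trans (map_zero _).symm), map_zero]

end Injective

section Torsion

variable [IsNoetherianRing R] {T Y Q : ModuleCat.{u} R} {f : T ⟶ Y} {g : Y ⟶ Q} {w : f ≫ g = 0}

/-- Quotienting by a torsion submodule does not change higher local cohomology. -/
lemma nonempty_dirLim_succ_equiv (hS : (ShortComplex.mk f g w).ShortExact)
    (hT : gamma I T = ⊤) (i : ℕ) :
    Nonempty (dirLim I (i + 1) Y ≃ₗ[R] dirLim I (i + 1) Q) := by
  refine nonempty_dirLim_equiv I
    (fun t ↦ (Ext.mk₀ g).postcompOfLinear R (quotPow I t) (add_zero (i + 1)))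
    (fun s t hst x ↦ (extTrans_comp hst x (Ext.mk₀ g) (add_zero _)).symm) (fun t x hx ↦ ?_)
    fun t y ↦ ?_
  · obtain ⟨z, rfl⟩ := Ext.covariant_sequence_exact₂ _ hS x hx
    obtain ⟨t', h, ht'⟩ := exists_extTrans_eq_zero_of_gamma_eq_top i T hT t z
    refine ⟨t', h, (extTrans_comp h z (Ext.mk₀ f) (add_zero _)).trans ?_⟩
    rw [ht', Ext.zero_comp]
  · obtain ⟨t', h, ht'⟩ := exists_extTrans_eq_zero_of_gamma_eq_top (i + 1) T hT t
      (Ext.comp y hS.extClass rfl)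
    exact ⟨t', h, Ext.covariant_sequence_exact₃ _ hS (extTrans I (i + 1) Q t t' h y) rfl
      ((extTrans_comp h y hS.extClass rfl).symm.trans ht')⟩

end Torsion

section DegreeZero

variable (I) in
/-- Evaluation at `1` of a morphism from `R ⧸ I ^ t`. -/
def extZeroToGamma (Y : ModuleCat.{u} R) (t : ℕ) :
    Abelian.Ext (quotPow I t) Y 0 →ₗ[R] gamma I Y :=
  (LinearMap.applyₗ (R := R) (Ideal.Quotient.mk (I ^ t) 1) ∘ₗ
    (Ext.linearEquiv₀.trans ModuleCat.homLinearEquiv).toLinearMap).codRestrict _ fun x ↦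
      map_mem_gamma (Ext.linearEquiv₀ (R := R) x).hom ⟨t, fun r hr ↦ smul_quotPow_eq_zero t r hr _⟩

lemma extZeroToGamma_mk₀ {Y : ModuleCat.{u} R} (t : ℕ) (φ : quotPow I t ⟶ Y) :
    (extZeroToGamma I Y t (Ext.mk₀ φ) : Y) = φ (Ideal.Quotient.mk (I ^ t) 1) := by
  have : Ext.linearEquiv₀ (R := R) (Ext.mk₀ φ) = φ := Ext.linearEquiv₀.apply_symm_apply φ
  change (Ext.linearEquiv₀ (R := R) (Ext.mk₀ φ)) (Ideal.Quotient.mk (I ^ t) 1) = _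
  rw [this]

variable (I) in
/-- The zeroth local cohomology is the torsion submodule. -/
lemma nonempty_dirLim_zero_equiv (Y : ModuleCat.{u} R) :
    Nonempty (dirLim I 0 Y ≃ₗ[R] gamma I Y) := by
  let L : dirLim I 0 Y →ₗ[R] gamma I Y := Module.DirectLimit.lift R ℕ _ (extTrans I 0 Y)
    (extZeroToGamma I Y) fun s t hst x ↦ by
      obtain ⟨φ, rfl⟩ := (Ext.mk₀_bijective _ _).2 x
      rw [extTrans_apply, Ext.mk₀_comp_mk₀]
      refine Subtype.ext ?_
      rw [extZeroToGamma_mk₀, extZeroToGamma_mk₀]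
      rfl
  refine ⟨LinearEquiv.ofBijective L ⟨?_, ?_⟩⟩
  · rw [injective_iff_map_eq_zero]
    intro z hz
    obtain ⟨t, x, rfl⟩ := Module.DirectLimit.exists_of z
    obtain ⟨φ, rfl⟩ := (Ext.mk₀_bijective _ _).2 x
    have h0 : φ (Ideal.Quotient.mk (I ^ t) 1) = 0 := by
      rw [← extZeroToGamma_mk₀]
      simpa [L] using hz
    have : φ = 0 := by
      ext
      exact h0
    rw [this, Ext.mk₀_zero, map_zero]
  · rintro ⟨y, t, ht⟩
    refine ⟨Module.DirectLimit.of R ℕ _ (extTrans I 0 Y) t (Ext.mk₀ (ModuleCat.ofHom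
      ((I ^ t).liftQ (LinearMap.toSpanSingleton R Y y) ht))), Subtype.ext ?_⟩
    simp only [L, Module.DirectLimit.lift_of]
    rw [extZeroToGamma_mk₀]
    exact one_smul R y

lemma gamma_eq_bot_of_subsingleton (Q : ModuleCat.{u} R) [Subsingleton (dirLim I 0 Q)] :
    gamma I Q = ⊥ := by
  obtain ⟨e⟩ := nonempty_dirLim_zero_equiv I Q
  have := e.symm.injective.subsingleton
  exact Submodule.eq_bot_of_subsingleton

end DegreeZero

end

section

variable {R : Type u} [CommRing R] {I : Ideal R}

variable {X : ModuleCat.{u} R}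

lemma finite_ext_of_linearEquiv {A B : ModuleCat.{u} R} (e : A ≃ₗ[R] B) (n : ℕ)
    [Module.Finite R (Abelian.Ext X A n)] : Module.Finite R (Abelian.Ext X B n) := by
  refine Module.Finite.of_surjective
    ((Ext.mk₀ e.toModuleIso.hom).postcompOfLinear R X (add_zero n)) fun y ↦
      ⟨y.comp (Ext.mk₀ e.toModuleIso.inv) (add_zero n), ?_⟩
  refine (Ext.comp_assoc_of_second_deg_zero _ _ _ (add_zero n)).trans ?_
  rw [Ext.mk₀_comp_mk₀, Iso.inv_hom_id, Ext.comp_mk₀_id]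

variable [IsNoetherianRing R]

lemma finite_ext_X₃ {S : ShortComplex (ModuleCat.{u} R)} (hS : S.ShortExact) (n : ℕ)
    [Module.Finite R (Abelian.Ext X S.X₂ n)] [Module.Finite R (Abelian.Ext X S.X₁ (n + 1))] :
    Module.Finite R (Abelian.Ext X S.X₃ n) := by
  have := isNoetherian_of_isNoetherianRing_of_finite R (Abelian.Ext X S.X₂ n)
  have := isNoetherian_of_isNoetherianRing_of_finite R (Abelian.Ext X S.X₁ (n + 1))
  have : IsNoetherian R (Abelian.Ext X S.X₃ n) := by
    refine isNoetherian_of_range_eq_ker ((Ext.mk₀ S.g).postcompOfLinear R X (add_zero n))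
      (hS.extClass.postcompOfLinear R X (show n + 1 = n + 1 from rfl)) (le_antisymm ?_ ?_)
    · rintro _ ⟨x, rfl⟩
      refine (Ext.comp_assoc x (Ext.mk₀ S.g) hS.extClass (add_zero n) (zero_add 1) (by lia)).trans ?_
      rw [hS.comp_extClass, Ext.comp_zero]
    · intro x hx
      exact Ext.covariant_sequence_exact₃ X hS x rfl hx
  infer_instance

/-- If all local cohomology modules of `Q` vanish, so do all `Ext` modules from modules
killed by a power of `I`. -/
lemma subsingleton_ext_of_subsingleton_dirLim {t : ℕ}
    (hX : ∀ r ∈ I ^ t, ∀ x : X, r • x = 0) (n : ℕ) (Q : ModuleCat.{u} R)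
    (hQ : ∀ i, Subsingleton (dirLim I i Q)) : Subsingleton (Abelian.Ext X Q n) := by
  have hQ' := gamma_eq_bot_of_subsingleton (I := I) Q
  induction n generalizing Q with
  | zero => exact subsingleton_ext_zero_of_gamma_eq_bot hQ' hX
  | succ n ih =>
    obtain ⟨E, B, j, q, w, hS, hE, hE'⟩ := exists_shortExact_injective Q hQ'
    have hB (i : ℕ) : Subsingleton (dirLim I i B) :=
      (nonempty_dirLim_equiv_succ hS hE' i).some.injective.subsingleton
    have := ih B hB (gamma_eq_bot_of_subsingleton B)
    exact (bijective_postcomp_extClass hS (X := X) n (subsingleton_ext_of_gamma_eq_bot hE' hX n)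
      (subsingleton_ext_of_gamma_eq_bot hE' hX (n + 1))).2.subsingleton

/-- The top local cohomology module is cofinite if the lower ones are finitely generated. -/
theorem finite_ext_dirLim [Module.Finite R X] {t : ℕ}
    (hX : ∀ r ∈ I ^ t, ∀ x : X, r • x = 0) (h : ℕ) (Y : ModuleCat.{u} R)
    (hY : ∀ n, Module.Finite R (Abelian.Ext X Y n))
    (hfg : ∀ i < h, Module.Finite R (dirLim I i Y))
    (hvanish : ∀ i, h < i → Subsingleton (dirLim I i Y)) (n : ℕ) :
    Module.Finite R (Abelian.Ext X (ModuleCat.of R (dirLim I h Y)) n) := by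
  induction h generalizing Y n with
  | zero =>
    obtain ⟨Q, i, p, w, hS, hQ⟩ := exists_shortExact_gamma I Y
    obtain ⟨eΓ⟩ := nonempty_dirLim_zero_equiv I Y
    have hQ₀ : Subsingleton (dirLim I 0 Q) := by
      obtain ⟨e⟩ := nonempty_dirLim_zero_equiv I Q
      rw [hQ] at e
      exact e.injective.subsingleton
    have eQ (i : ℕ) := nonempty_dirLim_succ_equiv hS (gamma_gamma Y) i
    have hQ' (n : ℕ) : Subsingleton (Abelian.Ext X Q n) := by
      refine subsingleton_ext_of_subsingleton_dirLim hX n Q fun i ↦ ?_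
      cases i with
      | zero => exact hQ₀
      | succ i =>
        have := hvanish (i + 1) i.succ_pos
        exact (eQ i).some.symm.injective.subsingleton
    have hΓ : Module.Finite R (Abelian.Ext X (ModuleCat.of R (gamma I Y)) n) := by
      refine Module.Finite.of_injective ((Ext.mk₀ i).postcompOfLinear R X (add_zero n)) ?_
      cases n with
      | zero =>
        have := hS.mono_f
        exact Ext.postcomp_mk₀_injective_of_mono X i
      | succ n =>
        rw [injective_iff_map_eq_zero]
        intro x hx
        obtain ⟨y, rfl⟩ := Ext.covariant_sequence_exact₁ X hS x hx rfl
        have := hQ' n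
        exact (congrArg (fun z ↦ Ext.comp z hS.extClass rfl) (Subsingleton.elim y 0)).trans
          (Ext.zero_comp ..)
    exact finite_ext_of_linearEquiv (A := ModuleCat.of R (gamma I Y)) eΓ.symm n
  | succ h ih =>
    obtain ⟨Q, i, p, w, hS, hQ⟩ := exists_shortExact_gamma I Y
    obtain ⟨eΓ⟩ := nonempty_dirLim_zero_equiv I Y
    have eQ (i : ℕ) := nonempty_dirLim_succ_equiv hS (gamma_gamma Y) i
    have : Module.Finite R (gamma I Y) :=
      have := hfg 0 h.succ_pos
      Module.Finite.equiv eΓ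
    have hQX (n : ℕ) : Module.Finite R (Abelian.Ext X Q n) := finite_ext_X₃ hS n
    obtain ⟨E, B, j, q, w', hS', hE, hE'⟩ := exists_shortExact_injective Q hQ
    have eB (i : ℕ) : Nonempty (dirLim I i B ≃ₗ[R] dirLim I (i + 1) Y) :=
      ⟨(nonempty_dirLim_equiv_succ hS' hE' i).some ≪≫ₗ (eQ i).some.symm⟩
    have hB (n : ℕ) : Module.Finite R (Abelian.Ext X B n) :=
      Module.Finite.of_injective _ (bijective_postcomp_extClass hS' (X := X) n
        (subsingleton_ext_of_gamma_eq_bot hE' hX n)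
        (subsingleton_ext_of_gamma_eq_bot hE' hX (n + 1))).1
    have hfB : Module.Finite R (Abelian.Ext X (ModuleCat.of R (dirLim I h B)) n) := by
      refine ih B hB (fun i hi ↦ ?_) (fun i hi ↦ ?_) n
      · have := hfg (i + 1) (Nat.succ_lt_succ hi)
        exact Module.Finite.equiv (eB i).some.symm
      · have := hvanish (i + 1) (Nat.succ_lt_succ hi)
        exact (eB i).some.injective.subsingleton
    exact finite_ext_of_linearEquiv (A := ModuleCat.of R (dirLim I h B)) (eB h).some n

end

end LocalCohomologyAux

theorem stmt6 (R : Type u) [CommRing R] [IsNoetherianRing R] (I : Ideal R)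
    (M : Type u) [AddCommGroup M] [Module R M] [Module.Finite R M] (h : ℕ)
    (hfg : ∀ i : ℕ, i < h → Module.Finite R ((localCohomology I i).obj (ModuleCat.of R M)))
    (hvanish : ∀ i : ℕ, h < i → Subsingleton ((localCohomology I i).obj (ModuleCat.of R M))) :
    ∀ i : ℕ, IsCofinite R I ((localCohomology I i).obj (ModuleCat.of R M)) := by
  open LocalCohomologyAux in
  have e (i : ℕ) := (nonempty_localCohomology_equiv I i (ModuleCat.of R M)).some
  refine fun i ↦ ⟨(e i).support_eq ▸ support_dirLim I i (ModuleCat.of R M), fun n ↦ ?_⟩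
  have key : Module.Finite R (Abelian.Ext (ModuleCat.of R (R ⧸ I))
      ((localCohomology I i).obj (ModuleCat.of R M)) n) := by
    rcases lt_trichotomy i h with hi | rfl | hi
    · have := hfg i hi
      infer_instance
    · have hX : ∀ r ∈ I ^ 1, ∀ x : R ⧸ I, r • x = 0 := by
        intro r hr x
        obtain ⟨x, rfl⟩ := Ideal.Quotient.mk_surjective x
        rw [pow_one] at hr
        exact Ideal.Quotient.eq_zero_iff_mem.2 (Ideal.mul_mem_right x I hr)
      have := finite_ext_dirLim (X := ModuleCat.of R (R ⧸ I)) hX i (ModuleCat.of R M)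
        (fun n ↦ inferInstance)
        (fun j hj ↦ have := hfg j hj; Module.Finite.equiv (e j))
        (fun j hj ↦ have := hvanish j hj; (e j).symm.injective.subsingleton) n
      exact finite_ext_of_linearEquiv (A := ModuleCat.of R (dirLim I i (ModuleCat.of R M)))
        (e i).symm n
    · have := hvanish i hi
      infer_instance
  exact Module.Finite.equiv (extLinearEquiv R _ _ n).symm
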